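/- arXiv:1004.0439 — 8 statements merged into one kernel-verified Lean document; each statement's English description precedes it below -/
import Mathlib

section
/- (Sklar's theorem, existence, bivariate case.) Let μ be a probability measure on ℝ × ℝ with joint distribution function G(x,y) = μ((−∞,x] × (−∞,y]) and marginal distribution functions F₁(x) = μ((−∞,x] × ℝ) and F₂(y) = μ(ℝ × (−∞,y]). Then there exists a copula C : [0,1] × [0,1] → ℝ such that G(x,y) = C(F₁(x), F₂(y)) for all x, y ∈ ℝ. -/
open Set MeasureTheory

/-- The conditional probability, given that a `ν`-distributed variable takes the value `x`, that its
distributional transform is at most `u`. -/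
noncomputable def transformCDF (ν : Measure ℝ) (u x : ℝ) : ℝ :=
  open Classical in
  if ν.real (Iic x) ≤ u then 1 else max 0 ((u - ν.real (Iio x)) / ν.real {x})

section TransformCDF

variable (ν : Measure ℝ)

theorem transformCDF_nonneg (u x : ℝ) : 0 ≤ transformCDF ν u x := by
  unfold transformCDF
  split_ifs
  · exact zero_le_one
  · exact le_max_left _ _

theorem transformCDF_of_le {u x : ℝ} (h : ν.real (Iic x) ≤ u) : transformCDF ν u x = 1 :=
  if_pos h

theorem transformCDF_eq_zero {u x : ℝ} (h : u < ν.real (Iic x)) (h' : u ≤ ν.real (Iio x)) :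
    transformCDF ν u x = 0 := by
  rw [transformCDF, if_neg h.not_ge]
  exact max_eq_left (div_nonpos_of_nonpos_of_nonneg (by linarith) measureReal_nonneg)

variable [IsProbabilityMeasure ν]

theorem measureReal_Iic_eq_Iio_add_singleton (x : ℝ) :
    ν.real (Iic x) = ν.real (Iio x) + ν.real {x} := by
  rw [← Iio_union_right, measureReal_union (by simp) (measurableSet_singleton x)]

theorem monotone_measureReal_Iic : Monotone fun x => ν.real (Iic x) :=
  fun _ _ h => measureReal_mono (Iic_subset_Iic.2 h)

theorem monotone_measureReal_Iio : Monotone fun x => ν.real (Iio x) :=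
  fun _ _ h => measureReal_mono (Iio_subset_Iio h)

theorem measurable_transformCDF (u : ℝ) : Measurable (transformCDF ν u) := by
  have hF := (monotone_measureReal_Iic ν).measurable
  have hL := (monotone_measureReal_Iio ν).measurable
  have hm : Measurable fun x => ν.real {x} := by
    convert hF.sub hL using 2 with x
    simp [measureReal_Iic_eq_Iio_add_singleton]
  exact Measurable.ite (measurableSet_le hF measurable_const) measurable_const
    (measurable_const.max ((measurable_const.sub hL).div hm))

theorem transformCDF_le_one (u x : ℝ) : transformCDF ν u x ≤ 1 := by
  unfold transformCDF
  split_ifs with h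
  · exact le_rfl
  · have hx := measureReal_Iic_eq_Iio_add_singleton ν x
    exact max_le zero_le_one (div_le_one_of_le₀ (by linarith) measureReal_nonneg)

theorem transformCDF_mono (x : ℝ) : Monotone fun u => transformCDF ν u x := by
  intro u v huv
  by_cases hv : ν.real (Iic x) ≤ v
  · simpa [transformCDF_of_le ν hv] using transformCDF_le_one ν u x
  · have hu : ¬ ν.real (Iic x) ≤ u := fun h => hv (h.trans huv)
    simp only [transformCDF, if_neg hu, if_neg hv]
    gcongr

theorem integrable_transformCDF (u : ℝ) : Integrable (transformCDF ν u) ν :=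
  Integrable.of_bound (measurable_transformCDF ν u).aestronglyMeasurable 1 <|
    .of_forall fun x => by
      rw [Real.norm_of_nonneg (transformCDF_nonneg ν u x)]
      exact transformCDF_le_one ν u x

/-- A measure of a set is controlled by the compact sets inside it, up to strict inequality. -/
theorem measureReal_le_of_forall_isCompact {s : Set ℝ} (hs : MeasurableSet s) {c : ℝ} (hc : 0 ≤ c)
    (h : ∀ K ⊆ s, IsCompact K → K.Nonempty → ν.real K ≤ c) : ν.real s ≤ c := by
  refine ENNReal.toReal_le_of_le_ofReal hc ?_
  rw [hs.measure_eq_iSup_isCompact_of_ne_top (measure_ne_top ν s)]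
  refine iSup₂_le fun K hKs => iSup_le fun hK => ?_
  rcases K.eq_empty_or_nonempty with rfl | hne
  · simp
  · exact (ENNReal.le_ofReal_iff_toReal_le (measure_ne_top ν K) hc).2 (h K hKs hK hne)

theorem integral_transformCDF {u : ℝ} (hu : u ∈ Icc (0 : ℝ) 1) :
    ∫ x, transformCDF ν u x ∂ν = u := by
  by_cases hjump : ∃ a, ν.real (Iio a) < u ∧ u < ν.real (Iic a)
  · obtain ⟨a, hLa, hFa⟩ := hjump
    have ha := measureReal_Iic_eq_Iio_add_singleton ν a
    have hm : 0 < ν.real {a} := by linarith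
    set c := (u - ν.real (Iio a)) / ν.real {a} with hc
    have hform : transformCDF ν u =
        fun x => (Iio a).indicator (fun _ => (1 : ℝ)) x + ({a} : Set ℝ).indicator (fun _ => c) x := by
      funext x
      rcases lt_trichotomy x a with h | rfl | h
      · have hx : ν.real (Iic x) ≤ ν.real (Iio a) := measureReal_mono (Iic_subset_Iio.2 h)
        rw [transformCDF_of_le ν (hx.trans hLa.le)]
        simp [h, h.ne]
      · rw [transformCDF, if_neg hFa.not_ge, max_eq_right (div_nonneg (by linarith) hm.le)]
        simp [hc]
      · have hx : ν.real (Iic a) ≤ ν.real (Iio x) := measureReal_mono (Iic_subset_Iio.2 h)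
        have hx' : ν.real (Iio x) ≤ ν.real (Iic x) := measureReal_mono Iio_subset_Iic_self
        rw [transformCDF_eq_zero ν (by linarith) (by linarith)]
        simp [h.le, h.ne']
    rw [hform, integral_add ((integrable_const _).indicator measurableSet_Iio)
      ((integrable_const _).indicator (measurableSet_singleton a)),
      integral_indicator_const _ measurableSet_Iio,
      integral_indicator_const _ (measurableSet_singleton a), smul_eq_mul, smul_eq_mul, hc]
    field_simp
    ring
  · have hno : ∀ x, u < ν.real (Iic x) → u ≤ ν.real (Iio x) := fun x hx =>
      not_lt.1 fun h => hjump ⟨x, h, hx⟩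
    set A := {x | ν.real (Iic x) ≤ u} with hA
    have hAm : MeasurableSet A :=
      measurableSet_le (monotone_measureReal_Iic ν).measurable measurable_const
    have hform : transformCDF ν u = A.indicator (fun _ => (1 : ℝ)) := by
      funext x
      by_cases hx : ν.real (Iic x) ≤ u
      · rw [transformCDF_of_le ν hx, indicator_of_mem (show x ∈ A from hx)]
      · rw [transformCDF_eq_zero ν (not_le.1 hx) (hno x (not_le.1 hx)),
          indicator_of_notMem (show x ∉ A from hx)]
    rw [hform, integral_indicator_const _ hAm, smul_eq_mul, mul_one]
    apply le_antisymm
    · refine measureReal_le_of_forall_isCompact ν hAm hu.1 fun K hKA hK hne => ?_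
      obtain ⟨b, hbK, hb⟩ := hK.exists_isGreatest hne
      exact (measureReal_mono fun x hx => hb hx).trans (hKA hbK)
    · have hcompl : ν.real Aᶜ ≤ 1 - u := by
        refine measureReal_le_of_forall_isCompact ν hAm.compl (by linarith [hu.2])
          fun K hKA hK hne => ?_
        obtain ⟨b, hbK, hb⟩ := hK.exists_isLeast hne
        have hKb : ν.real K ≤ ν.real (Iio b)ᶜ :=
          measureReal_mono fun x hx => not_lt.2 (hb hx)
        rw [probReal_compl_eq_one_sub measurableSet_Iio] at hKb
        linarith [hno b (not_le.1 (hKA hbK))]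
      rw [probReal_compl_eq_one_sub hAm] at hcompl
      linarith

theorem transformCDF_zero_ae : transformCDF ν 0 =ᵐ[ν] 0 :=
  (integral_eq_zero_iff_of_nonneg (transformCDF_nonneg ν 0) (integrable_transformCDF ν 0)).1
    (integral_transformCDF ν (by simp))

theorem transformCDF_one (x : ℝ) : transformCDF ν 1 x = 1 :=
  transformCDF_of_le ν measureReal_le_one

theorem transformCDF_measureReal_Iic_ae (a : ℝ) :
    transformCDF ν (ν.real (Iic a)) =ᵐ[ν] (Iic a).indicator 1 := by
  refine ((integral_eq_iff_of_ae_le ((integrable_const (1 : ℝ)).indicator measurableSet_Iic)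
    (integrable_transformCDF ν _) (.of_forall fun x => ?_)).1 ?_).symm
  · by_cases hx : x ≤ a
    · rw [transformCDF_of_le ν (monotone_measureReal_Iic ν hx), indicator_of_mem (mem_Iic.2 hx)]
    · rw [indicator_of_notMem (mt mem_Iic.1 hx)]
      exact transformCDF_nonneg ν _ x
  · rw [integral_transformCDF ν ⟨measureReal_nonneg, measureReal_le_one⟩,
      integral_indicator_const _ measurableSet_Iic, smul_eq_mul, mul_one]

end TransformCDF

/-- Sklar's theorem (existence, bivariate case): the joint distribution function of
a probability measure on `ℝ × ℝ` can be written as a copula applied to the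
marginal distribution functions. -/
theorem sklar_existence
    (μ : Measure (ℝ × ℝ)) [IsProbabilityMeasure μ]
    (G : ℝ → ℝ → ℝ) (F₁ F₂ : ℝ → ℝ)
    (hG : ∀ x y, G x y = (μ (Iic x ×ˢ Iic y)).toReal)
    (hF₁ : ∀ x, F₁ x = (μ (Iic x ×ˢ univ)).toReal)
    (hF₂ : ∀ y, F₂ y = (μ (univ ×ˢ Iic y)).toReal) :
    ∃ C : ℝ → ℝ → ℝ,
      (∀ u ∈ Icc (0:ℝ) 1, C u 0 = 0 ∧ C 0 u = 0) ∧
      (∀ u ∈ Icc (0:ℝ) 1, C u 1 = u ∧ C 1 u = u) ∧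
      (∀ u₁ ∈ Icc (0:ℝ) 1, ∀ u₂ ∈ Icc (0:ℝ) 1,
        ∀ v₁ ∈ Icc (0:ℝ) 1, ∀ v₂ ∈ Icc (0:ℝ) 1, u₁ ≤ u₂ → v₁ ≤ v₂ →
        0 ≤ C u₂ v₂ - C u₂ v₁ - C u₁ v₂ + C u₁ v₁) ∧
      (∀ x y : ℝ, G x y = C (F₁ x) (F₂ y)) := by
  have h1 : ∀ x, F₁ x = μ.fst.real (Iic x) := fun x => by
    rw [hF₁, measureReal_def, Measure.fst_apply measurableSet_Iic, prod_univ]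
  have h2 : ∀ y, F₂ y = μ.snd.real (Iic y) := fun y => by
    rw [hF₂, measureReal_def, Measure.snd_apply measurableSet_Iic, univ_prod]
  set p := transformCDF μ.fst
  set q := transformCDF μ.snd
  have ae_fst : ∀ {f g : ℝ → ℝ}, f =ᵐ[μ.fst] g → ∀ᵐ z ∂μ, f z.1 = g z.1 := fun h =>
    ae_of_ae_map measurable_fst.aemeasurable h
  have ae_snd : ∀ {f g : ℝ → ℝ}, f =ᵐ[μ.snd] g → ∀ᵐ z ∂μ, f z.2 = g z.2 := fun h =>
    ae_of_ae_map measurable_snd.aemeasurable h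
  have hint : ∀ u v, Integrable (fun z : ℝ × ℝ => p u z.1 * q v z.2) μ := fun u v =>
    Integrable.of_bound (((measurable_transformCDF _ u).comp measurable_fst).mul
      ((measurable_transformCDF _ v).comp measurable_snd)).aestronglyMeasurable 1 <|
      .of_forall fun z => by
        have hp := transformCDF_nonneg μ.fst u z.1
        have hq := transformCDF_nonneg μ.snd v z.2
        rw [Real.norm_of_nonneg (mul_nonneg hp hq)]
        exact mul_le_one₀ (transformCDF_le_one _ u _) hq (transformCDF_le_one _ v _)
  refine ⟨fun u v => ∫ z, p u z.1 * q v z.2 ∂μ, fun u _ => ⟨?_, ?_⟩, fun u hu => ⟨?_, ?_⟩, ?_, ?_⟩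
  · refine integral_eq_zero_of_ae ?_
    filter_upwards [ae_snd (transformCDF_zero_ae μ.snd)] with z hz
    simp [q, hz]
  · refine integral_eq_zero_of_ae ?_
    filter_upwards [ae_fst (transformCDF_zero_ae μ.fst)] with z hz
    simp [p, hz]
  · simp only [q, transformCDF_one, mul_one]
    exact (integral_map measurable_fst.aemeasurable
      (measurable_transformCDF _ _).aestronglyMeasurable).symm.trans (integral_transformCDF μ.fst hu)
  · simp only [p, transformCDF_one, one_mul]
    exact (integral_map measurable_snd.aemeasurable
      (measurable_transformCDF _ _).aestronglyMeasurable).symm.trans (integral_transformCDF μ.snd hu)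
  · intro u₁ _ u₂ _ v₁ _ v₂ _ hu hv
    dsimp only
    have hsub := (hint u₂ v₂).sub (hint u₂ v₁)
    rw [← integral_sub' (hint u₂ v₂) (hint u₂ v₁), ← integral_sub' hsub (hint u₁ v₂),
      ← integral_add' (hsub.sub (hint u₁ v₂)) (hint u₁ v₁)]
    refine integral_nonneg fun z => ?_
    have := mul_nonneg (sub_nonneg.2 (transformCDF_mono μ.fst z.1 hu))
      (sub_nonneg.2 (transformCDF_mono μ.snd z.2 hv))
    simp only [Pi.zero_apply, Pi.add_apply, Pi.sub_apply]
    linarith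
  · intro x y
    have hprod : (fun z : ℝ × ℝ => p (F₁ x) z.1 * q (F₂ y) z.2) =ᵐ[μ]
        (Iic x ×ˢ Iic y).indicator fun _ => (1 : ℝ) := by
      filter_upwards [ae_fst (transformCDF_measureReal_Iic_ae μ.fst x),
        ae_snd (transformCDF_measureReal_Iic_ae μ.snd y)] with z hz₁ hz₂
      simp only [p, q, h1, h2, hz₁, hz₂, indicator_apply, mem_prod, Pi.one_apply]
      split_ifs <;> simp_all
    dsimp only
    rw [integral_congr_ae hprod, integral_indicator_const _ (measurableSet_Iic.prod measurableSet_Iic),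
      hG, smul_eq_mul, mul_one, measureReal_def]
end

section
/- (Sklar's theorem, uniqueness for continuous marginals.) Let μ be a probability measure on ℝ × ℝ with joint distribution function G(x,y) = μ((−∞,x] × (−∞,y]) and marginal distribution functions F₁(x) = μ((−∞,x] × ℝ) and F₂(y) = μ(ℝ × (−∞,y]). Suppose F₁ and F₂ are continuous. If C and C' are copulas with G(x,y) = C(F₁(x), F₂(y)) and G(x,y) = C'(F₁(x), F₂(y)) for all x, y ∈ ℝ, then C(u,v) = C'(u,v) for all (u,v) in [0,1] × [0,1]. -/
open Set MeasureTheory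

/-- A continuous distribution function of a probability measure on `ℝ` attains every value
strictly between `0` and `1`. -/
theorem Ioo_subset_range_cdf_of_continuous (ν : Measure ℝ)
    (h : Continuous (ProbabilityTheory.cdf ν)) :
    Ioo (0 : ℝ) 1 ⊆ range (ProbabilityTheory.cdf ν) := fun _ hu ↦
  mem_range_of_exists_le_of_exists_ge h
    ((ProbabilityTheory.tendsto_cdf_atBot ν).eventually (eventually_le_nhds hu.1)).exists
    ((ProbabilityTheory.tendsto_cdf_atTop ν).eventually (eventually_ge_nhds hu.2)).exists

/-- Sklar's theorem (uniqueness for continuous marginals, bivariate case):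
if the marginal distribution functions are continuous, the copula representing
the joint distribution function is unique on the whole unit square. -/
theorem sklar_uniqueness
    (μ : Measure (ℝ × ℝ)) [IsProbabilityMeasure μ]
    (G : ℝ → ℝ → ℝ) (F₁ F₂ : ℝ → ℝ)
    (hG : ∀ x y, G x y = (μ (Iic x ×ˢ Iic y)).toReal)
    (hF₁ : ∀ x, F₁ x = (μ (Iic x ×ˢ univ)).toReal)
    (hF₂ : ∀ y, F₂ y = (μ (univ ×ˢ Iic y)).toReal)
    (hF₁cont : Continuous F₁) (hF₂cont : Continuous F₂)
    (C C' : ℝ → ℝ → ℝ)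
    (hCground : ∀ u ∈ Icc (0:ℝ) 1, C u 0 = 0 ∧ C 0 u = 0)
    (hCmarg : ∀ u ∈ Icc (0:ℝ) 1, C u 1 = u ∧ C 1 u = u)
    (hCincr : ∀ u₁ ∈ Icc (0:ℝ) 1, ∀ u₂ ∈ Icc (0:ℝ) 1,
      ∀ v₁ ∈ Icc (0:ℝ) 1, ∀ v₂ ∈ Icc (0:ℝ) 1, u₁ ≤ u₂ → v₁ ≤ v₂ →
      0 ≤ C u₂ v₂ - C u₂ v₁ - C u₁ v₂ + C u₁ v₁)
    (hC'ground : ∀ u ∈ Icc (0:ℝ) 1, C' u 0 = 0 ∧ C' 0 u = 0)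
    (hC'marg : ∀ u ∈ Icc (0:ℝ) 1, C' u 1 = u ∧ C' 1 u = u)
    (hC'incr : ∀ u₁ ∈ Icc (0:ℝ) 1, ∀ u₂ ∈ Icc (0:ℝ) 1,
      ∀ v₁ ∈ Icc (0:ℝ) 1, ∀ v₂ ∈ Icc (0:ℝ) 1, u₁ ≤ u₂ → v₁ ≤ v₂ →
      0 ≤ C' u₂ v₂ - C' u₂ v₁ - C' u₁ v₂ + C' u₁ v₁)
    (hCrep : ∀ x y : ℝ, G x y = C (F₁ x) (F₂ y))
    (hC'rep : ∀ x y : ℝ, G x y = C' (F₁ x) (F₂ y)) :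
    ∀ u ∈ Icc (0:ℝ) 1, ∀ v ∈ Icc (0:ℝ) 1, C u v = C' u v := by
  have h₁ : Ioo (0 : ℝ) 1 ⊆ range F₁ := by
    have : IsProbabilityMeasure (μ.map Prod.fst) :=
      Measure.isProbabilityMeasure_map measurable_fst.aemeasurable
    have hF : F₁ = ProbabilityTheory.cdf (μ.map Prod.fst) := by
      ext x
      rw [hF₁, ProbabilityTheory.cdf_eq_real, measureReal_def,
        Measure.map_apply measurable_fst measurableSet_Iic, prod_univ]
    rw [hF] at hF₁cont ⊢
    exact Ioo_subset_range_cdf_of_continuous _ hF₁cont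
  have h₂ : Ioo (0 : ℝ) 1 ⊆ range F₂ := by
    have : IsProbabilityMeasure (μ.map Prod.snd) :=
      Measure.isProbabilityMeasure_map measurable_snd.aemeasurable
    have hF : F₂ = ProbabilityTheory.cdf (μ.map Prod.snd) := by
      ext y
      rw [hF₂, ProbabilityTheory.cdf_eq_real, measureReal_def,
        Measure.map_apply measurable_snd measurableSet_Iic, univ_prod]
    rw [hF] at hF₂cont ⊢
    exact Ioo_subset_range_cdf_of_continuous _ hF₂cont
  intro u hu v hv
  rcases hu.1.eq_or_lt with rfl | hu0
  · rw [(hCground v hv).2, (hC'ground v hv).2]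
  rcases hu.2.eq_or_lt with rfl | hu1
  · rw [(hCmarg v hv).2, (hC'marg v hv).2]
  rcases hv.1.eq_or_lt with rfl | hv0
  · rw [(hCground u hu).1, (hC'ground u hu).1]
  rcases hv.2.eq_or_lt with rfl | hv1
  · rw [(hCmarg u hu).1, (hC'marg u hu).1]
  obtain ⟨x, rfl⟩ := h₁ ⟨hu0, hu1⟩
  obtain ⟨y, rfl⟩ := h₂ ⟨hv0, hv1⟩
  rw [← hCrep, ← hC'rep]
end

section
/- Let f : ℝ → ℝ be a probability density function with cumulative distribution function F(x) = ∫_{−∞}^x f(t) dt, finite mean x̄ = ∫ x f(x) dx, and finite variance σ² = ∫ (x − x̄)² f(x) dx. Then (∫ x [2F(x) − 1] f(x) dx)² ≤ σ²/3. -/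
open MeasureTheory

/-- Integration by parts for primitives of integrable functions against a measure without atoms. -/
theorem integral_mul_setIntegral_Iic_add {ν : Measure ℝ} [SFinite ν] [NullSingletonClass ν] {g h : ℝ → ℝ}
    (hg : Integrable g ν) (hh : Integrable h ν) :
    (∫ x, g x * ∫ t in Set.Iic x, h t ∂ν ∂ν) + (∫ x, h x * ∫ t in Set.Iic x, g t ∂ν ∂ν)
      = (∫ x, g x ∂ν) * ∫ x, h x ∂ν := by
  have hφ : Integrable (fun p : ℝ × ℝ => g p.1 * h p.2) (ν.prod ν) := hg.mul_prod hh
  have hA : MeasurableSet {p : ℝ × ℝ | p.2 ≤ p.1} := measurableSet_le measurable_snd measurable_fst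
  rw [← integral_prod_mul, ← integral_add_compl hA hφ]
  congr 1
  · rw [← integral_indicator hA, integral_prod _ (hφ.indicator hA)]
    refine integral_congr_ae (.of_forall fun x => ?_)
    dsimp only
    rw [← integral_const_mul, ← integral_indicator measurableSet_Iic]
    rfl
  · rw [← integral_indicator hA.compl, integral_prod_symm _ (hφ.indicator hA.compl)]
    refine integral_congr_ae (.of_forall fun x => ?_)
    dsimp only
    rw [setIntegral_congr_set Iio_ae_eq_Iic.symm, ← integral_const_mul,
      ← integral_indicator measurableSet_Iio]
    refine integral_congr_ae (.of_forall fun y => ?_)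
    simp [Set.indicator_apply, mul_comm]

theorem setIntegral_Iic_mul_setIntegral_Iic {f : ℝ → ℝ} (hf : Integrable f) (x : ℝ) :
    ∫ y in Set.Iic x, f y * ∫ t in Set.Iic y, f t = (∫ t in Set.Iic x, f t) ^ 2 / 2 := by
  have h := integral_mul_setIntegral_Iic_add (ν := volume.restrict (Set.Iic x))
    hf.integrableOn hf.integrableOn
  have e : ∫ y in Set.Iic x, f y * ∫ t in Set.Iic y, f t ∂(volume.restrict (Set.Iic x))
      = ∫ y in Set.Iic x, f y * ∫ t in Set.Iic y, f t := by
    refine setIntegral_congr_fun measurableSet_Iic fun y hy => ?_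
    rw [Measure.restrict_restrict measurableSet_Iic,
      Set.inter_eq_left.2 (Set.Iic_subset_Iic.2 hy)]
  rw [e] at h
  linarith

/-- Cauchy–Schwarz bound for the FGM covariance factor: for a probability
density `f` with CDF `F`, mean `m` and variance `σ² = ∫ (x-m)² f(x) dx`,
`(∫ x [2F(x)-1] f(x) dx)² ≤ σ²/3`. -/
theorem fgm_factor_sq_le_variance_third
    (f : ℝ → ℝ)
    (hfpos : ∀ x, 0 ≤ f x) (hfint : Integrable f) (hfnorm : ∫ x, f x = 1)
    (F : ℝ → ℝ) (hF : ∀ x, F x = ∫ t in Set.Iic x, f t)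
    (m : ℝ) (hm : m = ∫ x, x * f x)
    (hxfint : Integrable (fun x => x * f x))
    (hvarint : Integrable (fun x => (x - m) ^ 2 * f x)) :
    (∫ x, x * (2 * F x - 1) * f x) ^ 2 ≤ (∫ x, (x - m) ^ 2 * f x) / 3 := by
  have hmono : Monotone F := fun a b hab => by
    rw [hF, hF]
    exact setIntegral_mono_set hfint.integrableOn (.of_forall hfpos)
      (Set.Iic_subset_Iic.2 hab).eventuallyLE
  have hF0 : ∀ x, 0 ≤ F x := fun x => by
    rw [hF]; exact setIntegral_nonneg measurableSet_Iic fun t _ => hfpos t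
  have hF1 : ∀ x, F x ≤ 1 := fun x => by
    rw [hF, ← hfnorm]; exact setIntegral_le_integral hfint (.of_forall hfpos)
  have hFm : AEStronglyMeasurable F := hmono.measurable.aestronglyMeasurable
  have mulF : ∀ {g : ℝ → ℝ}, Integrable g → Integrable (fun x => g x * F x) := fun hg =>
    hg.mul_bdd (c := 1) hFm (.of_forall fun x => by
      rw [Real.norm_eq_abs, abs_of_nonneg (hF0 x)]; exact hF1 x)
  have i1 : Integrable (fun x => f x * F x) := mulF hfint
  have i2 : Integrable (fun x => f x * F x * F x) := mulF i1
  have i3 : Integrable (fun x => x * f x * F x) := mulF hxfint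
  have e1 : ∫ x, f x * F x = 1 / 2 := by
    have h := integral_mul_setIntegral_Iic_add hfint hfint
    simp only [← hF, hfnorm] at h
    linarith
  have e2 : ∫ x, f x * F x * F x = 1 / 3 := by
    have h := integral_mul_setIntegral_Iic_add hfint i1
    have h' : ∀ x, ∫ t in Set.Iic x, f t * F t = F x ^ 2 / 2 := fun x => by
      simpa only [← hF] using setIntegral_Iic_mul_setIntegral_Iic hfint x
    simp only [h', ← hF, hfnorm, e1] at h
    have h2 : ∫ x, f x * (F x ^ 2 / 2) = (∫ x, f x * F x * F x) / 2 := by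
      rw [← integral_div]; congr 1; ext x; ring
    linarith
  set c := ∫ x, x * (2 * F x - 1) * f x with hc
  set V := ∫ x, (x - m) ^ 2 * f x with hV
  have ec : c = 2 * (∫ x, x * f x * F x) - m := by
    rw [hc, hm, ← integral_const_mul, ← integral_sub (i3.const_mul 2) hxfint]
    congr 1; ext x; ring
  have key : ∫ x, (3 * c * (2 * F x - 1) - (x - m)) ^ 2 * f x = V - 3 * c ^ 2 := by
    have expand : (fun x => (3 * c * (2 * F x - 1) - (x - m)) ^ 2 * f x) = fun x =>
        (x - m) ^ 2 * f x + (36 * c ^ 2) * (f x * F x * F x)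
          + (12 * c * m - 36 * c ^ 2) * (f x * F x) + (-12 * c) * (x * f x * F x)
          + (6 * c) * (x * f x) + (9 * c ^ 2 - 6 * c * m) * f x := by
      ext x; ring
    rw [expand, integral_add (by fun_prop) (by fun_prop), integral_add (by fun_prop) (by fun_prop),
      integral_add (by fun_prop) (by fun_prop), integral_add (by fun_prop) (by fun_prop),
      integral_add (by fun_prop) (by fun_prop)]
    simp only [integral_const_mul, e1, e2, hfnorm, ← hm, ← hV]
    linear_combination (6 * c) * ec
  have hnn : 0 ≤ ∫ x, (3 * c * (2 * F x - 1) - (x - m)) ^ 2 * f x :=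
    integral_nonneg fun x => mul_nonneg (sq_nonneg _) (hfpos x)
  linarith
end

section
/- Let f₁, f₂ : ℝ → ℝ be probability density functions with cumulative distribution functions F₁, F₂, each with finite mean x̄ⱼ and finite positive variance σⱼ², and let g(x₁,x₂) = f₁(x₁) f₂(x₂) [1 + κ(2F₁(x₁) − 1)(2F₂(x₂) − 1)] be the FGM joint density with |κ| ≤ 1. Then the Pearson correlation coefficient ρ = [∬ (x₁ − x̄₁)(x₂ − x̄₂) g(x₁,x₂) dx₁ dx₂] / (σ₁ σ₂) satisfies |ρ| ≤ 1/3. -/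
open MeasureTheory

section CDF

open Filter Topology

variable {f F : ℝ → ℝ} {m : ℝ}

theorem cdf_eq_add_intervalIntegral (hf : Integrable f)
    (hF : ∀ x, F x = ∫ t in Set.Iic x, f t) (a x : ℝ) :
    F x = F a + ∫ t in a..x, f t := by
  rw [hF, hF, ← intervalIntegral.integral_Iic_sub_Iic hf.integrableOn hf.integrableOn]
  ring

theorem continuous_cdf (hf : Integrable f) (hF : ∀ x, F x = ∫ t in Set.Iic x, f t) :
    Continuous F := by
  rw [funext (cdf_eq_add_intervalIntegral hf hF 0)]
  exact continuous_const.add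
    (intervalIntegral.continuous_primitive (fun _ _ => hf.intervalIntegrable) 0)

theorem absolutelyContinuousOnInterval_cdf (hf : Integrable f)
    (hF : ∀ x, F x = ∫ t in Set.Iic x, f t) (a b : ℝ) :
    AbsolutelyContinuousOnInterval F a b := by
  rw [funext (cdf_eq_add_intervalIntegral hf hF a)]
  have hconst : AbsolutelyContinuousOnInterval (fun _ : ℝ => F a) a b :=
    contDiff_const.contDiffOn.absolutelyContinuousOnInterval
  exact hconst.fun_add
    (hf.intervalIntegrable.absolutelyContinuousOnInterval_intervalIntegral (by simp))

theorem ae_hasDerivAt_cdf (hf : Integrable f) (hF : ∀ x, F x = ∫ t in Set.Iic x, f t) :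
    ∀ᵐ x, HasDerivAt F (f x) x := by
  filter_upwards [LocallyIntegrable.ae_hasDerivAt_integral hf.locallyIntegrable] with x hx
  rw [funext (cdf_eq_add_intervalIntegral hf hF 0)]
  exact (hx 0).const_add _

theorem abs_two_mul_cdf_sub_one_le (hpos : ∀ x, 0 ≤ f x) (hf : Integrable f)
    (hnorm : ∫ x, f x = 1) (hF : ∀ x, F x = ∫ t in Set.Iic x, f t) (x : ℝ) :
    |2 * F x - 1| ≤ 1 := by
  have h0 : 0 ≤ F x := hF x ▸ integral_nonneg hpos
  have h1 : F x ≤ 1 := by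
    rw [hF, ← hnorm]
    exact setIntegral_le_integral hf (ae_of_all _ hpos)
  rw [abs_le]
  constructor <;> linarith

theorem integrable_mul_two_mul_cdf_sub_one {h : ℝ → ℝ} (hh : Integrable h)
    (hpos : ∀ x, 0 ≤ f x) (hf : Integrable f) (hnorm : ∫ x, f x = 1)
    (hF : ∀ x, F x = ∫ t in Set.Iic x, f t) :
    Integrable (fun x => h x * (2 * F x - 1)) :=
  hh.mul_bdd (c := 1) (by have := continuous_cdf hf hF; fun_prop)
    (ae_of_all _ (abs_two_mul_cdf_sub_one_le hpos hf hnorm hF))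

theorem integrable_mul_two_mul_cdf_sub_one_sq (hpos : ∀ x, 0 ≤ f x) (hf : Integrable f)
    (hnorm : ∫ x, f x = 1) (hF : ∀ x, F x = ∫ t in Set.Iic x, f t) :
    Integrable (fun x => f x * (2 * F x - 1) ^ 2) := by
  simpa only [pow_two, mul_assoc] using integrable_mul_two_mul_cdf_sub_one
    (integrable_mul_two_mul_cdf_sub_one hf hpos hf hnorm hF) hpos hf hnorm hF

theorem integral_mul_two_mul_cdf_sub_one_sq (hpos : ∀ x, 0 ≤ f x) (hf : Integrable f)
    (hnorm : ∫ x, f x = 1) (hF : ∀ x, F x = ∫ t in Set.Iic x, f t) :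
    ∫ x, f x * (2 * F x - 1) ^ 2 = 1 / 3 := by
  have hFTC (r : ℝ) : ∫ x in -r..r, f x * (2 * F x - 1) ^ 2 =
      ((2 * F r - 1) ^ 3 - (2 * F (-r) - 1) ^ 3) / 6 := by
    have hconst : AbsolutelyContinuousOnInterval (fun _ : ℝ => (1 : ℝ)) (-r) r :=
      contDiff_const.contDiffOn.absolutelyContinuousOnInterval
    have hG := ((absolutelyContinuousOnInterval_cdf hf hF (-r) r).const_mul 2).fun_sub hconst
    have h := ((hG.fun_mul hG).fun_mul hG).integral_deriv_eq_sub
    have hderiv : ∫ x in -r..r, deriv (fun x =>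
        (2 * F x - 1) * (2 * F x - 1) * (2 * F x - 1)) x =
        ∫ x in -r..r, 6 * (f x * (2 * F x - 1) ^ 2) := by
      refine intervalIntegral.integral_congr_ae ?_
      filter_upwards [ae_hasDerivAt_cdf hf hF] with x hx _
      have hx' := (hx.const_mul 2).sub_const 1
      rw [((hx'.fun_mul hx').fun_mul hx').deriv]
      ring
    rw [hderiv, intervalIntegral.integral_const_mul] at h
    linarith
  have htop : Tendsto F atTop (𝓝 1) := by
    rw [funext hF, ← hnorm]
    exact (aecover_Iic tendsto_id).integral_tendsto_of_countably_generated hf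
  have hbot : Tendsto (fun r => F (-r)) atTop (𝓝 0) := by
    simp_rw [hF]
    exact tendsto_integral_Iic_zero tendsto_neg_atTop_atBot
  have hlim := intervalIntegral_tendsto_integral
    (integrable_mul_two_mul_cdf_sub_one_sq hpos hf hnorm hF) tendsto_neg_atTop_atBot tendsto_id
  refine tendsto_nhds_unique hlim ?_
  simp only [id, hFTC]
  convert ((((htop.const_mul 2).sub_const 1).pow 3).sub
    (((hbot.const_mul 2).sub_const 1).pow 3)).div_const 6 using 2
  norm_num

theorem integrable_sub_const_mul (hf : Integrable f) (hxf : Integrable (fun x => x * f x)) :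
    Integrable (fun x => (x - m) * f x) := by
  simp_rw [sub_mul]
  exact hxf.sub (hf.const_mul m)

theorem integral_sub_mean_mul (hf : Integrable f) (hnorm : ∫ x, f x = 1)
    (hxf : Integrable (fun x => x * f x)) (hm : m = ∫ x, x * f x) :
    ∫ x, (x - m) * f x = 0 := by
  simp_rw [sub_mul]
  rw [integral_sub hxf (hf.const_mul m), integral_const_mul, hnorm, ← hm]
  ring

theorem abs_integral_sub_mul_two_mul_cdf_sub_one_le (hpos : ∀ x, 0 ≤ f x) (hf : Integrable f)
    (hnorm : ∫ x, f x = 1) (hF : ∀ x, F x = ∫ t in Set.Iic x, f t)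
    (hxf : Integrable (fun x => x * f x)) (hvar : Integrable (fun x => (x - m) ^ 2 * f x)) {σ : ℝ}
    (hσ : σ = Real.sqrt (∫ x, (x - m) ^ 2 * f x)) :
    |∫ x, (x - m) * f x * (2 * F x - 1)| ≤ σ / Real.sqrt 3 := by
  have hA := integrable_mul_two_mul_cdf_sub_one (integrable_sub_const_mul (m := m) hf hxf)
    hpos hf hnorm hF
  have hB := integrable_mul_two_mul_cdf_sub_one_sq hpos hf hnorm hF
  set V := ∫ x, (x - m) ^ 2 * f x
  set A := ∫ x, (x - m) * f x * (2 * F x - 1)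
  have hquad (t : ℝ) : 0 ≤ V * (t * t) + (-2 * A) * t + 1 / 3 := by
    have hnonneg : 0 ≤ ∫ x, (t * (x - m) - (2 * F x - 1)) ^ 2 * f x :=
      integral_nonneg fun x => mul_nonneg (sq_nonneg _) (hpos x)
    have hdiff : Integrable (fun x =>
        t ^ 2 * ((x - m) ^ 2 * f x) - 2 * t * ((x - m) * f x * (2 * F x - 1))) :=
      (hvar.const_mul _).sub (hA.const_mul _)
    have hexpand : ∫ x, (t * (x - m) - (2 * F x - 1)) ^ 2 * f x =
        t ^ 2 * V - 2 * t * A + 1 / 3 := by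
      rw [← integral_mul_two_mul_cdf_sub_one_sq hpos hf hnorm hF, ← integral_const_mul,
        ← integral_const_mul, ← integral_sub (hvar.const_mul _) (hA.const_mul _),
        ← integral_add hdiff hB]
      congr 1 with x
      ring
    linarith
  have hdiscrim := discrim_le_zero hquad
  rw [discrim] at hdiscrim
  rw [hσ, ← Real.sqrt_div' _ (by norm_num)]
  exact Real.abs_le_sqrt (by linarith)

end CDF

/-- The Pearson correlation coefficient of the two coordinates under the FGM
joint density with `|κ| ≤ 1` satisfies `|ρ| ≤ 1/3`. -/
theorem fgm_correlation_le_third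
    (f₁ f₂ : ℝ → ℝ) (κ : ℝ) (hκ : |κ| ≤ 1)
    (hf₁pos : ∀ x, 0 ≤ f₁ x) (hf₂pos : ∀ x, 0 ≤ f₂ x)
    (hf₁int : Integrable f₁) (hf₂int : Integrable f₂)
    (hf₁norm : ∫ x, f₁ x = 1) (hf₂norm : ∫ x, f₂ x = 1)
    (hxf₁int : Integrable (fun x => x * f₁ x))
    (hxf₂int : Integrable (fun x => x * f₂ x))
    (m₁ m₂ : ℝ) (hm₁ : m₁ = ∫ x, x * f₁ x) (hm₂ : m₂ = ∫ x, x * f₂ x)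
    (hvar₁int : Integrable (fun x => (x - m₁) ^ 2 * f₁ x))
    (hvar₂int : Integrable (fun x => (x - m₂) ^ 2 * f₂ x))
    (σ₁ σ₂ : ℝ)
    (hσ₁ : σ₁ = Real.sqrt (∫ x, (x - m₁) ^ 2 * f₁ x))
    (hσ₂ : σ₂ = Real.sqrt (∫ x, (x - m₂) ^ 2 * f₂ x))
    (hσ₁pos : 0 < σ₁) (hσ₂pos : 0 < σ₂)
    (F₁ F₂ : ℝ → ℝ)
    (hF₁ : ∀ x, F₁ x = ∫ t in Set.Iic x, f₁ t)
    (hF₂ : ∀ x, F₂ x = ∫ t in Set.Iic x, f₂ t)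
    (g : ℝ → ℝ → ℝ)
    (hg : ∀ x₁ x₂, g x₁ x₂ =
      f₁ x₁ * f₂ x₂ * (1 + κ * (2 * F₁ x₁ - 1) * (2 * F₂ x₂ - 1)))
    (ρ : ℝ)
    (hρ : ρ = (∫ x₁, ∫ x₂, (x₁ - m₁) * (x₂ - m₂) * g x₁ x₂) / (σ₁ * σ₂)) :
    |ρ| ≤ 1 / 3 := by
  set A₁ := ∫ x, (x - m₁) * f₁ x * (2 * F₁ x - 1) with hA₁
  set A₂ := ∫ x, (x - m₂) * f₂ x * (2 * F₂ x - 1) with hA₂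
  have hinner (x₁ : ℝ) : ∫ x₂, (x₁ - m₁) * (x₂ - m₂) * g x₁ x₂ =
      κ * A₂ * ((x₁ - m₁) * f₁ x₁ * (2 * F₁ x₁ - 1)) := by
    have hcent := integrable_sub_const_mul (m := m₂) hf₂int hxf₂int
    calc ∫ x₂, (x₁ - m₁) * (x₂ - m₂) * g x₁ x₂
        = ∫ x₂, ((x₁ - m₁) * f₁ x₁ * ((x₂ - m₂) * f₂ x₂) +
            κ * ((x₁ - m₁) * f₁ x₁ * (2 * F₁ x₁ - 1)) *
              ((x₂ - m₂) * f₂ x₂ * (2 * F₂ x₂ - 1))) := by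
          congr 1 with x₂
          rw [hg]
          ring
      _ = κ * A₂ * ((x₁ - m₁) * f₁ x₁ * (2 * F₁ x₁ - 1)) := by
          rw [integral_add (hcent.const_mul _)
            ((integrable_mul_two_mul_cdf_sub_one hcent hf₂pos hf₂int hf₂norm hF₂).const_mul _),
            integral_const_mul, integral_const_mul,
            integral_sub_mean_mul hf₂int hf₂norm hxf₂int hm₂, ← hA₂]
          ring
  have hb₁ : |A₁| ≤ σ₁ / Real.sqrt 3 := abs_integral_sub_mul_two_mul_cdf_sub_one_le
    hf₁pos hf₁int hf₁norm hF₁ hxf₁int hvar₁int hσ₁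
  have hb₂ : |A₂| ≤ σ₂ / Real.sqrt 3 := abs_integral_sub_mul_two_mul_cdf_sub_one_le
    hf₂pos hf₂int hf₂norm hF₂ hxf₂int hvar₂int hσ₂
  have hσ := mul_pos hσ₁pos hσ₂pos
  simp_rw [hinner] at hρ
  rw [hρ, integral_const_mul, ← hA₁, abs_div, abs_of_pos hσ, div_le_iff₀ hσ, abs_mul, abs_mul]
  calc |κ| * |A₂| * |A₁| ≤ 1 * (σ₂ / Real.sqrt 3) * (σ₁ / Real.sqrt 3) := by gcongr
    _ = σ₁ * σ₂ / Real.sqrt 3 ^ 2 := by ring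
    _ = 1 / 3 * (σ₁ * σ₂) := by
      rw [Real.sq_sqrt (by norm_num)]
      ring
end

section
/- Let a > 0 and let f_a(x) = x^{a−1} e^{−x} / Γ(a) for x > 0 (and 0 for x ≤ 0) be the Gamma density with shape a and unit rate, with cumulative distribution function F_a(x) = ∫_0^x f_a(t) dt. Then ∫_0^∞ x [2F_a(x) − 1] f_a(x) dx = 2^{1−2a} Γ(2a) / Γ(a)². -/
open MeasureTheory

/-- For the Gamma density `f_a` with shape `a > 0` and unit rate, with CDF
`F_a(x) = ∫_0^x f_a`, one has
`∫_0^∞ x (2F_a(x) - 1) f_a(x) dx = 2^(1-2a) Γ(2a) / Γ(a)²`. -/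
theorem gamma_fgm_moment_integral
    (a : ℝ) (ha : 0 < a)
    (f F : ℝ → ℝ)
    (hf : ∀ x : ℝ, f x =
      if 0 < x then x ^ (a - 1) * Real.exp (-x) / Real.Gamma a else 0)
    (hF : ∀ x : ℝ, F x = ∫ t in (0:ℝ)..x, f t) :
    ∫ x in Set.Ioi (0:ℝ), x * (2 * F x - 1) * f x =
      (2:ℝ) ^ (1 - 2 * a) * Real.Gamma (2 * a) / (Real.Gamma a) ^ 2 := by
  have hG : 0 < Real.Gamma a := Real.Gamma_pos_of_pos ha
  have hf_pos : ∀ x, 0 < x → f x = x ^ (a - 1) * Real.exp (-x) / Real.Gamma a :=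
    fun x hx => by rw [hf, if_pos hx]
  have hf_nonneg : ∀ x, 0 ≤ f x := by
    intro x
    rw [hf]
    split_ifs <;> positivity
  have hf_int_Ioi : IntegrableOn f (Set.Ioi 0) := by
    refine IntegrableOn.congr_fun
      ((Real.GammaIntegral_convergent ha).div_const (Real.Gamma a)) ?_ measurableSet_Ioi
    intro x hx
    simp only [hf_pos x hx]
    ring
  have hf_int : Integrable f := by
    refine (integrableOn_iff_integrable_of_support_subset ?_).1 hf_int_Ioi
    intro x hx
    by_contra h
    exact hx (by rw [hf, if_neg (Set.notMem_Ioi.1 h).not_gt])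
  have hf_total : ∫ x in Set.Ioi (0:ℝ), f x = 1 := by
    rw [← div_self hG.ne', Real.Gamma_eq_integral ha, ← integral_div,
      ← Real.Gamma_eq_integral ha]
    refine setIntegral_congr_fun measurableSet_Ioi fun x hx => ?_
    simp only [hf_pos x hx]
    ring
  have hF_cont : Continuous F := by
    rw [funext hF]
    exact intervalIntegral.continuous_primitive (fun _ _ => hf_int.intervalIntegrable) 0
  have hF_zero : F 0 = 0 := by simp [hF]
  have hF_top : Filter.Tendsto F Filter.atTop (nhds 1) := by
    rw [funext hF, ← hf_total]
    exact intervalIntegral_tendsto_integral_Ioi 0 hf_int_Ioi Filter.tendsto_id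
  have hF_nonneg : ∀ x, 0 < x → 0 ≤ F x := fun x hx => by
    rw [hF]
    exact intervalIntegral.integral_nonneg hx.le fun t _ => hf_nonneg t
  have hF_le : ∀ x, 0 < x → F x ≤ 1 := fun x hx => by
    rw [hF, intervalIntegral.integral_of_le hx.le, ← hf_total]
    exact setIntegral_mono_set hf_int_Ioi (Filter.Eventually.of_forall hf_nonneg)
      Set.Ioc_subset_Ioi_self.eventuallyLE
  have hf_cont : ∀ x, 0 < x → ContinuousAt f x := fun x hx => by
    have h : ContinuousAt (fun y : ℝ => y ^ (a - 1) * Real.exp (-y) / Real.Gamma a) x := by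
      have := Real.continuousAt_rpow_const x (a - 1) (Or.inl hx.ne')
      fun_prop
    refine h.congr ?_
    filter_upwards [lt_mem_nhds hx] with y hy
    exact (hf_pos y hy).symm
  have hF_deriv : ∀ x, 0 < x → HasDerivAt F (f x) x := fun x hx => by
    rw [funext hF]
    exact intervalIntegral.integral_hasDerivAt_right hf_int.intervalIntegrable
      hf_int.1.stronglyMeasurableAtFilter (hf_cont x hx)
  set g : ℝ → ℝ := fun x => x ^ a * Real.exp (-x) / Real.Gamma a with hg
  have hgf : ∀ x, 0 < x → g x = x * f x := fun x hx => by
    rw [hf_pos x hx, hg, Real.rpow_sub_one hx.ne']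
    field_simp
  have hg_cont : Continuous g := by
    have := Real.continuous_rpow_const ha.le
    fun_prop
  have hg_zero : g 0 = 0 := by simp [hg, Real.zero_rpow ha.ne']
  have hg_top : Filter.Tendsto g Filter.atTop (nhds 0) := by
    have := (tendsto_rpow_mul_exp_neg_mul_atTop_nhds_zero a 1 one_pos).div_const (Real.Gamma a)
    simpa [hg] using this
  have hg_deriv : ∀ x, 0 < x → HasDerivAt g ((a - x) * f x) x := fun x hx => by
    have h1 := Real.hasDerivAt_rpow_const (p := a) (Or.inl hx.ne')
    have h2 := (hasDerivAt_neg x).exp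
    refine ((h1.mul h2).div_const (Real.Gamma a)).congr_deriv ?_
    rw [hf_pos x hx, Real.rpow_sub_one hx.ne']
    field_simp
    ring
  have hg_int : IntegrableOn g (Set.Ioi 0) := by
    refine IntegrableOn.congr_fun ((Real.GammaIntegral_convergent (s := a + 1)
      (by linarith)).div_const (Real.Gamma a)) ?_ measurableSet_Ioi
    intro x _
    simp only [hg, add_sub_cancel_right]
    ring
  have h_int : IntegrableOn (fun x => x * (2 * F x - 1) * f x) (Set.Ioi 0) := by
    have h : IntegrableOn (fun x => (2 * F x - 1) * g x) (Set.Ioi 0) := by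
      refine Integrable.bdd_mul (c := 1) hg_int
        (by fun_prop : Continuous fun x => 2 * F x - 1).aestronglyMeasurable ?_
      filter_upwards [ae_restrict_mem measurableSet_Ioi] with x hx
      rw [Real.norm_eq_abs, abs_le]
      constructor <;> linarith [hF_nonneg x hx, hF_le x hx]
    refine h.congr_fun ?_ measurableSet_Ioi
    intro x hx
    simp only [hgf x hx]
    ring
  have hsq : ∀ x, 0 < x → x * f x ^ 2 =
      x ^ (2 * a - 1) * Real.exp (-(2 * x)) / Real.Gamma a ^ 2 := fun x hx => by
    rw [hf_pos x hx, Real.rpow_sub_one hx.ne', Real.rpow_sub_one hx.ne', two_mul a,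
      Real.rpow_add hx, two_mul x, neg_add, Real.exp_add]
    field_simp
  have hsq_int : IntegrableOn (fun x => x * f x ^ 2) (Set.Ioi 0) := by
    have h := integrableOn_rpow_mul_exp_neg_mul_rpow (p := 1) (s := 2 * a - 1) (b := 2)
      (by linarith) one_pos two_pos
    refine IntegrableOn.congr_fun (h.div_const (Real.Gamma a ^ 2)) ?_ measurableSet_Ioi
    intro x hx
    simp only [hsq x hx, Real.rpow_one, neg_mul]
  have hsq_val : ∫ x in Set.Ioi (0:ℝ), x * f x ^ 2 =
      (1 / 2) ^ (2 * a) * Real.Gamma (2 * a) / Real.Gamma a ^ 2 := by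
    rw [← Real.integral_rpow_mul_exp_neg_mul_Ioi (by linarith) two_pos, ← integral_div]
    exact setIntegral_congr_fun measurableSet_Ioi hsq
  have key : ∫ x in Set.Ioi (0:ℝ), (x * (2 * F x - 1) * f x - 2 * (x * f x ^ 2)) = 0 := by
    have h := integral_Ioi_of_hasDerivAt_of_tendsto (a := 0) (m := 0)
      (f := fun x => a * (F x ^ 2 - F x) - g x * (2 * F x - 1))
      (f' := fun x => x * (2 * F x - 1) * f x - 2 * (x * f x ^ 2))
      (by fun_prop) ?_ (h_int.sub (hsq_int.const_mul 2)) ?_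
    · simpa [hF_zero, hg_zero] using h
    · intro x hx
      have hFx := hF_deriv x hx
      refine ((((hFx.pow 2).sub hFx).const_mul a).sub
        ((hg_deriv x hx).mul ((hFx.const_mul 2).sub_const 1))).congr_deriv ?_
      rw [hgf x hx]
      push_cast
      ring
    · have := (((hF_top.pow 2).sub hF_top).const_mul a).sub
        (hg_top.mul ((hF_top.const_mul 2).sub_const 1))
      simpa using this
  rw [integral_sub h_int (hsq_int.const_mul 2), integral_const_mul, hsq_val, sub_eq_zero] at key
  rw [key, Real.rpow_sub two_pos, Real.rpow_one, Real.div_rpow one_pos.le two_pos.le,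
    Real.one_rpow]
  ring
end

section
/- Let a, b > 0 and let f_a, f_b be Gamma densities with shapes a and b and unit rate, with CDFs F_a, F_b. Let g(x₁,x₂) = f_a(x₁) f_b(x₂)[1 + κ(2F_a(x₁) − 1)(2F_b(x₂) − 1)] be the FGM joint density with |κ| ≤ 1. Then the Pearson correlation coefficient of the two coordinates under g equals ρ = (κ / √(ab)) · (2^{1−2a} / B(a,a)) · (2^{1−2b} / B(b,b)), where B(a,b) = Γ(a)Γ(b)/Γ(a+b) is the Beta function. -/
open MeasureTheory

/-- The density of the Gamma law with shape `a` and unit rate. -/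
noncomputable def gammaDensity (a x : ℝ) : ℝ :=
  if 0 < x then x ^ (a - 1) * Real.exp (-x) / Real.Gamma a else 0

/-- The cumulative distribution function of `gammaDensity a` on the positive half-line. -/
noncomputable def gammaCDF (a x : ℝ) : ℝ := ∫ t in (0:ℝ)..x, gammaDensity a t

/-- The product `x * gammaDensity a x` for `0 < x`, written in closed form. -/
noncomputable def gammaFlux (a x : ℝ) : ℝ := x ^ a * Real.exp (-x) / Real.Gamma a

lemma gammaDensity_of_pos (a : ℝ) {x : ℝ} (hx : 0 < x) :
    gammaDensity a x = x ^ (a - 1) * Real.exp (-x) / Real.Gamma a := if_pos hx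

lemma gammaDensity_of_nonpos (a : ℝ) {x : ℝ} (hx : ¬ 0 < x) : gammaDensity a x = 0 := if_neg hx

lemma mul_gammaDensity (a : ℝ) {x : ℝ} (hx : 0 < x) : x * gammaDensity a x = gammaFlux a x := by
  rw [gammaDensity_of_pos a hx, gammaFlux, Real.rpow_sub_one hx.ne']
  field_simp

lemma integrable_gammaDensity {a : ℝ} (ha : 0 < a) : Integrable (gammaDensity a) := by
  rw [← integrableOn_iff_integrable_of_support_subset (s := Set.Ioi 0)]
  · refine IntegrableOn.congr_fun ((Real.GammaIntegral_convergent ha).div_const (Real.Gamma a))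
      (fun x hx => ?_) measurableSet_Ioi
    simp only [gammaDensity_of_pos a hx, mul_comm]
  · intro x hx
    by_contra h
    exact hx (gammaDensity_of_nonpos a h)

lemma integrable_mul_gammaDensity {a : ℝ} (ha : 0 < a) :
    Integrable (fun x => x * gammaDensity a x) := by
  rw [← integrableOn_iff_integrable_of_support_subset (s := Set.Ioi 0)]
  · refine IntegrableOn.congr_fun ((Real.GammaIntegral_convergent (s := a + 1)
      (by linarith)).div_const (Real.Gamma a)) (fun x hx => ?_) measurableSet_Ioi
    simp only [mul_gammaDensity a hx, gammaFlux, mul_comm, add_sub_cancel_right]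
  · intro x hx
    by_contra h
    exact hx (by simp [gammaDensity_of_nonpos a h])

lemma integrable_sub_mul_gammaDensity {a : ℝ} (ha : 0 < a) :
    Integrable (fun x => (x - a) * gammaDensity a x) := by
  simp only [sub_mul]
  exact (integrable_mul_gammaDensity ha).sub ((integrable_gammaDensity ha).const_mul a)

lemma continuousAt_gammaDensity (a : ℝ) {x : ℝ} (hx : 0 < x) :
    ContinuousAt (gammaDensity a) x := by
  have h : ContinuousAt (fun y => y ^ (a - 1) * Real.exp (-y) / Real.Gamma a) x :=
    ((Real.continuousAt_rpow_const x _ (Or.inl hx.ne')).mul (by fun_prop)).div_const _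
  refine h.congr ?_
  filter_upwards [lt_mem_nhds hx] with y hy
  exact (gammaDensity_of_pos a hy).symm

lemma continuous_gammaCDF {a : ℝ} (ha : 0 < a) : Continuous (gammaCDF a) :=
  (integrable_gammaDensity ha).continuous_primitive 0

lemma hasDerivAt_gammaCDF {a x : ℝ} (ha : 0 < a) (hx : 0 < x) :
    HasDerivAt (gammaCDF a) (gammaDensity a x) x :=
  intervalIntegral.integral_hasDerivAt_right (integrable_gammaDensity ha).intervalIntegrable
    ((integrable_gammaDensity ha).aestronglyMeasurable.stronglyMeasurableAtFilter)
    (continuousAt_gammaDensity a hx)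

lemma abs_gammaCDF_le {a : ℝ} (ha : 0 < a) (x : ℝ) :
    |gammaCDF a x| ≤ ∫ t, ‖gammaDensity a t‖ :=
  intervalIntegral.norm_integral_le_integral_norm_uIoc.trans
    (setIntegral_le_integral (integrable_gammaDensity ha).norm
      (Filter.Eventually.of_forall fun _ => norm_nonneg _))

lemma integrable_sub_mul_gammaDensity_mul_cdf {a : ℝ} (ha : 0 < a) :
    Integrable (fun x => (x - a) * gammaDensity a x * (2 * gammaCDF a x - 1)) := by
  refine (integrable_sub_mul_gammaDensity ha).mul_bdd
    (c := 2 * (∫ t, ‖gammaDensity a t‖) + 1) ?_ (Filter.Eventually.of_forall fun x => ?_)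
  · have := continuous_gammaCDF ha
    exact Continuous.aestronglyMeasurable (by fun_prop)
  · have := abs_le.1 (abs_gammaCDF_le ha x)
    rw [Real.norm_eq_abs, abs_le]
    constructor <;> linarith

lemma continuous_gammaFlux {a : ℝ} (ha : 0 < a) : Continuous (gammaFlux a) :=
  ((Real.continuous_rpow_const ha.le).mul (by fun_prop)).div_const _

lemma tendsto_gammaFlux (a : ℝ) : Filter.Tendsto (gammaFlux a) Filter.atTop (nhds 0) := by
  unfold gammaFlux
  simpa using
    (tendsto_rpow_mul_exp_neg_mul_atTop_nhds_zero a 1 one_pos).div_const (Real.Gamma a)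

lemma gammaFlux_zero {a : ℝ} (ha : 0 < a) : gammaFlux a 0 = 0 := by
  simp [gammaFlux, Real.zero_rpow ha.ne']

lemma hasDerivAt_gammaFlux (a : ℝ) {x : ℝ} (hx : 0 < x) :
    HasDerivAt (gammaFlux a) (-((x - a) * gammaDensity a x)) x := by
  have h := ((Real.hasDerivAt_rpow_const (p := a) (Or.inl hx.ne')).mul
    (hasDerivAt_neg x).exp).div_const (Real.Gamma a)
  refine h.congr_deriv ?_
  rw [gammaDensity_of_pos a hx, Real.rpow_sub_one hx.ne']
  field_simp
  ring

lemma integral_sub_mul_gammaDensity {a : ℝ} (ha : 0 < a) :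
    ∫ x, (x - a) * gammaDensity a x = 0 := by
  have h := integral_Ioi_of_hasDerivAt_of_tendsto
    (continuous_gammaFlux ha).continuousWithinAt
    (fun x hx => hasDerivAt_gammaFlux a hx)
    (integrable_sub_mul_gammaDensity ha).neg.integrableOn (tendsto_gammaFlux a)
  rw [integral_neg, gammaFlux_zero ha, setIntegral_eq_integral_of_forall_compl_eq_zero
    (fun x hx => by rw [gammaDensity_of_nonpos a hx, mul_zero])] at h
  linarith

lemma integral_gammaFlux_mul_gammaDensity {a : ℝ} (ha : 0 < a) :
    ∫ x in Set.Ioi (0 : ℝ), gammaFlux a x * gammaDensity a x =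
      (1 / 2) ^ (2 * a) * Real.Gamma (2 * a) / Real.Gamma a ^ 2 := by
  rw [← Real.integral_rpow_mul_exp_neg_mul_Ioi (by positivity) two_pos, ← integral_div]
  refine setIntegral_congr_fun measurableSet_Ioi fun x hx => ?_
  have hx : 0 < x := hx
  simp only [gammaFlux, gammaDensity_of_pos a hx]
  rw [show 2 * a - 1 = a + (a - 1) by ring, Real.rpow_add hx,
    show -(2 * x) = -x + -x by ring, Real.exp_add]
  ring

lemma integral_sub_mul_gammaDensity_mul_cdf {a : ℝ} (ha : 0 < a) :
    ∫ x, (x - a) * gammaDensity a x * (2 * gammaCDF a x - 1) =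
      2 ^ (1 - 2 * a) / (Real.Gamma a * Real.Gamma a / Real.Gamma (a + a)) := by
  have hΓ := Real.Gamma_pos_of_pos ha
  have hΓ₂ := Real.Gamma_pos_of_pos (show 0 < 2 * a by positivity)
  have hflux := integral_gammaFlux_mul_gammaDensity ha
  have hint : IntegrableOn (fun x => gammaFlux a x * gammaDensity a x) (Set.Ioi 0) :=
    Integrable.of_integral_ne_zero (by rw [hflux]; positivity)
  have hcont := continuous_gammaCDF ha
  have hF : Filter.Tendsto (fun x => 2 * gammaCDF a x - 1) Filter.atTop
      (nhds (2 * (∫ t in Set.Ioi 0, gammaDensity a t) - 1)) :=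
    ((intervalIntegral_tendsto_integral_Ioi 0 (integrable_gammaDensity ha).integrableOn
      Filter.tendsto_id).const_mul 2).sub_const 1
  have hlim := (tendsto_gammaFlux a).mul hF
  rw [zero_mul] at hlim
  have hint' := (integrable_sub_mul_gammaDensity_mul_cdf ha).integrableOn (s := Set.Ioi 0)
  have h := integral_Ioi_of_hasDerivAt_of_tendsto (a := 0)
    (f := fun x => gammaFlux a x * (2 * gammaCDF a x - 1))
    (f' := fun x => 2 * (gammaFlux a x * gammaDensity a x) -
      (x - a) * gammaDensity a x * (2 * gammaCDF a x - 1))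
    ((continuous_gammaFlux ha).mul (by fun_prop)).continuousWithinAt
    (fun x hx => ((hasDerivAt_gammaFlux a hx).mul
      (((hasDerivAt_gammaCDF ha hx).const_mul 2).sub_const 1)).congr_deriv (by ring))
    ((hint.const_mul 2).sub hint') hlim
  rw [integral_sub (hint.const_mul 2) hint', integral_const_mul, hflux, gammaFlux_zero ha,
    setIntegral_eq_integral_of_forall_compl_eq_zero
      (fun x hx => by rw [gammaDensity_of_nonpos a hx]; ring)] at h
  rw [← sub_eq_zero.1 (h.trans (by ring)), ← two_mul, Real.rpow_sub two_pos, Real.rpow_one,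
    one_div, Real.inv_rpow two_pos.le]
  field_simp

/-- The Pearson correlation coefficient of the FGM joint density with Gamma
marginals of shapes `a, b` and unit rate (whose means are `a, b` and standard
deviations `√a, √b`) equals
`κ/√(ab) · (2^(1-2a)/B(a,a)) · (2^(1-2b)/B(b,b))`,
where `B(a,b) = Γ(a)Γ(b)/Γ(a+b)`. -/
theorem gamma_fgm_correlation
    (a b κ : ℝ) (ha : 0 < a) (hb : 0 < b) (hκ : |κ| ≤ 1)
    (f₁ f₂ F₁ F₂ : ℝ → ℝ)
    (hf₁ : ∀ x : ℝ, f₁ x =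
      if 0 < x then x ^ (a - 1) * Real.exp (-x) / Real.Gamma a else 0)
    (hf₂ : ∀ x : ℝ, f₂ x =
      if 0 < x then x ^ (b - 1) * Real.exp (-x) / Real.Gamma b else 0)
    (hF₁ : ∀ x : ℝ, F₁ x = ∫ t in (0:ℝ)..x, f₁ t)
    (hF₂ : ∀ x : ℝ, F₂ x = ∫ t in (0:ℝ)..x, f₂ t)
    (g : ℝ → ℝ → ℝ)
    (hg : ∀ x₁ x₂, g x₁ x₂ =
      f₁ x₁ * f₂ x₂ * (1 + κ * (2 * F₁ x₁ - 1) * (2 * F₂ x₂ - 1)))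
    (B : ℝ → ℝ → ℝ)
    (hB : ∀ s t, B s t = Real.Gamma s * Real.Gamma t / Real.Gamma (s + t))
    (ρ : ℝ)
    (hρ : ρ = (∫ x₁, ∫ x₂, (x₁ - a) * (x₂ - b) * g x₁ x₂) /
      (Real.sqrt a * Real.sqrt b)) :
    ρ = κ / Real.sqrt (a * b) * ((2:ℝ) ^ (1 - 2 * a) / B a a) *
      ((2:ℝ) ^ (1 - 2 * b) / B b b) := by
  obtain rfl : f₁ = gammaDensity a := funext hf₁
  obtain rfl : f₂ = gammaDensity b := funext hf₂
  obtain rfl : F₁ = gammaCDF a := funext hF₁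
  obtain rfl : F₂ = gammaCDF b := funext hF₂
  have hinner (x₁ : ℝ) : ∫ x₂, (x₁ - a) * (x₂ - b) * g x₁ x₂ =
      (x₁ - a) * gammaDensity a x₁ * (2 * gammaCDF a x₁ - 1) *
        (κ * ((2:ℝ) ^ (1 - 2 * b) / B b b)) := by
    have hsplit (x₂ : ℝ) : (x₁ - a) * (x₂ - b) * g x₁ x₂ =
        (x₁ - a) * gammaDensity a x₁ * ((x₂ - b) * gammaDensity b x₂) +
        (x₁ - a) * gammaDensity a x₁ * (2 * gammaCDF a x₁ - 1) * κ *
          ((x₂ - b) * gammaDensity b x₂ * (2 * gammaCDF b x₂ - 1)) := by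
      rw [hg]
      ring
    simp_rw [hsplit]
    rw [integral_add ((integrable_sub_mul_gammaDensity hb).const_mul _)
      ((integrable_sub_mul_gammaDensity_mul_cdf hb).const_mul _), integral_const_mul,
      integral_const_mul, integral_sub_mul_gammaDensity hb,
      integral_sub_mul_gammaDensity_mul_cdf hb, hB]
    ring
  simp_rw [hinner] at hρ
  rw [hρ, integral_mul_const, integral_sub_mul_gammaDensity_mul_cdf ha, ← hB,
    Real.sqrt_mul ha.le]
  ring
end

section
/- Let |ρ| < 1 and let f₁, f₂ : ℝ → ℝ be probability density functions whose cumulative distribution functions F₁, F₂ are continuous and strictly increasing on ℝ (so that 0 < Fⱼ(x) < 1 for all x). Define the Gaussian-copula joint density g(x₁,x₂) = c^G(F₁(x₁), F₂(x₂); ρ) · f₁(x₁) f₂(x₂), where c^G(u,v;ρ) = ψ₂(Φ⁻¹(u), Φ⁻¹(v); ρ) / (φ(Φ⁻¹(u)) φ(Φ⁻¹(v))). Then for every x₁ ∈ ℝ, ∫_ℝ g(x₁,x₂) dx₂ = f₁(x₁); that is, the Gaussian-copula bivariate density has f₁ and f₂ as its marginal densities. -/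
open Set MeasureTheory

namespace ProbabilityTheory

/-- A real function with nonnegative values and total integral one is the density of a
probability measure. -/
theorem isProbabilityMeasure_withDensity_ofReal {f : ℝ → ℝ} (hpos : ∀ x, 0 ≤ f x)
    (hint : Integrable f) (hnorm : ∫ x, f x = 1) :
    IsProbabilityMeasure (volume.withDensity fun x => ENNReal.ofReal (f x)) := by
  refine ⟨?_⟩
  rw [withDensity_apply _ MeasurableSet.univ, Measure.restrict_univ,
    ← ofReal_integral_eq_lintegral_ofReal hint (ae_of_all _ hpos), hnorm, ENNReal.ofReal_one]

/-- The distribution function of a measure with density `f` is the integral of `f`. -/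
theorem cdf_withDensity_ofReal {f : ℝ → ℝ} (hpos : ∀ x, 0 ≤ f x)
    (hint : Integrable f) (hnorm : ∫ x, f x = 1) (x : ℝ) :
    cdf (volume.withDensity fun x => ENNReal.ofReal (f x)) x = ∫ t in Iic x, f t := by
  have := isProbabilityMeasure_withDensity_ofReal hpos hint hnorm
  rw [cdf_eq_real, measureReal_def, withDensity_apply _ measurableSet_Iic,
    ← ofReal_integral_eq_lintegral_ofReal hint.integrableOn (ae_of_all _ hpos),
    ENNReal.toReal_ofReal (integral_nonneg hpos)]

/-- A continuous distribution function attains every value in `(0, 1)`. -/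
theorem exists_cdf_eq {μ : Measure ℝ} (hc : Continuous (cdf μ)) {u : ℝ} (hu : u ∈ Ioo (0 : ℝ) 1) :
    ∃ x, cdf μ x = u := by
  obtain ⟨a, ha⟩ := ((tendsto_cdf_atBot μ).eventually_lt_const hu.1).exists
  obtain ⟨b, hb⟩ := ((tendsto_cdf_atTop μ).eventually_const_lt hu.2).exists
  exact mem_range_of_exists_le_of_exists_ge hc ⟨a, ha.le⟩ ⟨b, hb.le⟩

/-- If `cdf ν ∘ T = cdf μ`, where both distribution functions are strictly increasing, `cdf μ` is
continuous and `cdf ν` takes values in `(0, 1)`, then `T` transports `μ` to `ν`. -/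
theorem map_eq_of_cdf_comp_eq {μ ν : Measure ℝ} [IsProbabilityMeasure μ] [IsProbabilityMeasure ν]
    {T : ℝ → ℝ} (hT : ∀ x, cdf ν (T x) = cdf μ x) (hc : Continuous (cdf μ))
    (hμ : StrictMono (cdf μ)) (hν : StrictMono (cdf ν)) (hrange : ∀ y, cdf ν y ∈ Ioo (0 : ℝ) 1) :
    Measurable T ∧ μ.map T = ν := by
  have hTmeas : Measurable T := by
    refine Monotone.measurable fun s t hst => ?_
    rw [← hν.le_iff_le, hT, hT]
    exact hμ.monotone hst
  refine ⟨hTmeas, ?_⟩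
  have := Measure.isProbabilityMeasure_map (μ := μ) hTmeas.aemeasurable
  refine Measure.eq_of_cdf _ _ (StieltjesFunction.ext fun y => ?_)
  obtain ⟨x, hx⟩ := exists_cdf_eq hc (hrange y)
  have hpre : T ⁻¹' Iic y = Iic x := by
    ext t
    rw [mem_preimage, mem_Iic, mem_Iic, ← hν.le_iff_le, hT, ← hx, hμ.le_iff_le]
  rw [cdf_eq_real, measureReal_def, Measure.map_apply hTmeas measurableSet_Iic, hpre,
    ← measureReal_def, ← cdf_eq_real, hx]

theorem gaussianPDFReal_zero_one (x : ℝ) :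
    gaussianPDFReal 0 1 x = (1 / Real.sqrt (2 * Real.pi)) * Real.exp (-x ^ 2 / 2) := by
  simp [gaussianPDFReal]

/-- Given the first coordinate, the second coordinate of a standard bivariate normal vector with
correlation `ρ` is normal with mean `ρ a` and variance `1 - ρ ^ 2`. -/
theorem bivariate_gaussian_density_eq {ρ : ℝ} (hρ : |ρ| < 1) (a y : ℝ) :
    (1 / (2 * Real.pi * Real.sqrt (1 - ρ ^ 2))) *
      Real.exp (-(a ^ 2 + y ^ 2 - 2 * ρ * a * y) / (2 * (1 - ρ ^ 2))) =
    gaussianPDFReal 0 1 a * gaussianPDFReal (ρ * a) (1 - ρ ^ 2).toNNReal y := by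
  have hv : 0 < 1 - ρ ^ 2 := by
    have := (sq_lt_one_iff_abs_lt_one ρ).2 hρ
    linarith
  rw [gaussianPDFReal_zero_one, gaussianPDFReal, Real.coe_toNNReal _ hv.le,
    Real.sqrt_mul (by positivity) (1 - ρ ^ 2), mul_mul_mul_comm, ← Real.exp_add]
  congr 1
  · have h2 : Real.sqrt (2 * Real.pi) * Real.sqrt (2 * Real.pi) = 2 * Real.pi :=
      Real.mul_self_sqrt (by positivity)
    rw [one_div, one_div, ← mul_inv, ← mul_assoc, h2]
  · congr 1
    field_simp
    ring

end ProbabilityTheory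

open ProbabilityTheory

/-- The Gaussian-copula joint density
`g(x₁,x₂) = c^G(F₁(x₁), F₂(x₂); ρ) f₁(x₁) f₂(x₂)`, built from probability
densities `f₁, f₂` whose CDFs are continuous, strictly increasing and take
values in `(0,1)`, has `f₁` as the marginal density of the first coordinate. -/
theorem gaussian_copula_marginal
    (ρ : ℝ) (hρ : |ρ| < 1)
    (φ Φ Φinv : ℝ → ℝ) (ψ₂ : ℝ → ℝ → ℝ) (cG : ℝ → ℝ → ℝ)
    (hφ : ∀ x, φ x = (1 / Real.sqrt (2 * Real.pi)) * Real.exp (-x ^ 2 / 2))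
    (hΦ : ∀ x, Φ x = ∫ t in Iic x, φ t)
    (hΦrange : ∀ x, Φ x ∈ Ioo (0:ℝ) 1)
    (hΦinv : ∀ x, Φinv (Φ x) = x)
    (hΦinv' : ∀ u ∈ Ioo (0:ℝ) 1, Φ (Φinv u) = u)
    (hψ₂ : ∀ x₁ x₂, ψ₂ x₁ x₂ = (1 / (2 * Real.pi * Real.sqrt (1 - ρ ^ 2))) *
      Real.exp (-(x₁ ^ 2 + x₂ ^ 2 - 2 * ρ * x₁ * x₂) / (2 * (1 - ρ ^ 2))))
    (hcG : ∀ u ∈ Ioo (0:ℝ) 1, ∀ v ∈ Ioo (0:ℝ) 1,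
      cG u v = ψ₂ (Φinv u) (Φinv v) / (φ (Φinv u) * φ (Φinv v)))
    (f₁ f₂ : ℝ → ℝ)
    (hf₁pos : ∀ x, 0 ≤ f₁ x) (hf₂pos : ∀ x, 0 ≤ f₂ x)
    (hf₁int : Integrable f₁) (hf₂int : Integrable f₂)
    (hf₁norm : ∫ x, f₁ x = 1) (hf₂norm : ∫ x, f₂ x = 1)
    (F₁ F₂ : ℝ → ℝ)
    (hF₁ : ∀ x, F₁ x = ∫ t in Iic x, f₁ t)
    (hF₂ : ∀ x, F₂ x = ∫ t in Iic x, f₂ t)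
    (hF₁cont : Continuous F₁) (hF₂cont : Continuous F₂)
    (hF₁mono : StrictMono F₁) (hF₂mono : StrictMono F₂)
    (hF₁range : ∀ x, F₁ x ∈ Ioo (0:ℝ) 1) (hF₂range : ∀ x, F₂ x ∈ Ioo (0:ℝ) 1)
    (g : ℝ → ℝ → ℝ)
    (hg : ∀ x₁ x₂, g x₁ x₂ = cG (F₁ x₁) (F₂ x₂) * f₁ x₁ * f₂ x₂) :
    ∀ x₁, ∫ x₂, g x₁ x₂ = f₁ x₁ := by
  intro x₁
  have hφg : φ = gaussianPDFReal 0 1 := by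
    ext x
    rw [hφ, gaussianPDFReal_zero_one]
  have hν : gaussianReal 0 1 = volume.withDensity fun x => ENNReal.ofReal (φ x) := by
    rw [gaussianReal_of_var_ne_zero _ one_ne_zero, hφg]
    rfl
  have hφpos : ∀ x, 0 < φ x := fun x => by
    rw [hφg]
    exact gaussianPDFReal_pos _ _ _ one_ne_zero
  have hcdfν : ∀ y, cdf (gaussianReal 0 1) y = Φ y := fun y => by
    rw [hν, hΦ, cdf_withDensity_ofReal (fun x => (hφpos x).le)
      (hφg ▸ integrable_gaussianPDFReal 0 1)
      (hφg ▸ integral_gaussianPDFReal_eq_one 0 one_ne_zero)]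
  set μ : Measure ℝ := volume.withDensity fun x => ENNReal.ofReal (f₂ x) with hμ
  have : IsProbabilityMeasure μ :=
    isProbabilityMeasure_withDensity_ofReal hf₂pos hf₂int hf₂norm
  have hcdfμ : (cdf μ : ℝ → ℝ) = F₂ := by
    ext x
    rw [hF₂, hμ, cdf_withDensity_ofReal hf₂pos hf₂int hf₂norm]
  have hνmono : StrictMono (cdf (gaussianReal 0 1)) := by
    refine (monotone_cdf _).strictMono_of_injective fun x y hxy => ?_
    rw [hcdfν, hcdfν] at hxy
    rw [← hΦinv x, hxy, hΦinv]
  obtain ⟨hTmeas, hTmap⟩ := map_eq_of_cdf_comp_eq (μ := μ) (ν := gaussianReal 0 1)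
    (T := fun x => Φinv (F₂ x)) (fun x => by rw [hcdfν, hcdfμ, hΦinv' _ (hF₂range x)])
    (hcdfμ ▸ hF₂cont) (hcdfμ ▸ hF₂mono) hνmono (fun y => hcdfν y ▸ hΦrange y)
  set a := Φinv (F₁ x₁) with ha
  set p : ℝ → ℝ := gaussianPDFReal (ρ * a) (1 - ρ ^ 2).toNNReal with hp
  have hcond : ∀ y, ψ₂ a y / (φ a * φ y) = p y / φ y := fun y => by
    rw [hψ₂, bivariate_gaussian_density_eq hρ, ← hφg, mul_div_mul_left _ _ (hφpos a).ne']
  have hpmeas : Measurable fun y => p y / φ y := by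
    rw [hφg]
    exact (measurable_gaussianPDFReal _ _).div (measurable_gaussianPDFReal _ _)
  have hvar : (1 - ρ ^ 2).toNNReal ≠ 0 := by
    have := (sq_lt_one_iff_abs_lt_one ρ).2 hρ
    exact (Real.toNNReal_pos.2 (by linarith)).ne'
  have hint_ν : ∫ y, p y / φ y ∂(gaussianReal 0 1) = 1 := by
    rw [integral_gaussianReal_eq_integral_smul one_ne_zero, ← hφg]
    simp_rw [smul_eq_mul, mul_div_cancel₀ _ (hφpos _).ne']
    exact integral_gaussianPDFReal_eq_one _ hvar
  have hint_μ : ∫ x, p (Φinv (F₂ x)) / φ (Φinv (F₂ x)) ∂μ = 1 := by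
    rw [← hint_ν, ← hTmap, integral_map hTmeas.aemeasurable hpmeas.aestronglyMeasurable]
  have hint_f : ∫ x, f₂ x * (p (Φinv (F₂ x)) / φ (Φinv (F₂ x))) = 1 := by
    rw [← hint_μ, hμ, integral_withDensity_eq_integral_toReal_smul₀
      hf₂int.aemeasurable.ennreal_ofReal (ae_of_all _ fun _ => ENNReal.ofReal_lt_top)]
    simp_rw [ENNReal.toReal_ofReal (hf₂pos _), smul_eq_mul]
  calc ∫ x₂, g x₁ x₂
      = ∫ x₂, f₁ x₁ * (f₂ x₂ * (p (Φinv (F₂ x₂)) / φ (Φinv (F₂ x₂)))) := by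
        refine integral_congr_ae (ae_of_all _ fun x₂ => ?_)
        simp only [hg, hcG _ (hF₁range x₁) _ (hF₂range x₂), ← ha, hcond]
        ring
    _ = f₁ x₁ := by rw [integral_const_mul, hint_f, mul_one]
end

section
/- Let f₁, f₂ : ℝ → ℝ be probability density functions with cumulative distribution functions F₁, F₂, each with finite mean x̄ⱼ and finite second moment, and let g(x₁,x₂) = f₁(x₁) f₂(x₂){1 + κ₁[2F₁(x₁) − 1][2F₂(x₂) − 1] + κ₂ F₁(x₁)F₂(x₂)[3F₁(x₁) − 2][3F₂(x₂) − 2]} be the one-iteration iterated FGM joint density. Then the covariance of the two coordinates under g satisfies ∬ (x₁ − x̄₁)(x₂ − x̄₂) g(x₁,x₂) dx₁ dx₂ = κ₁ · (∫ x₁ f₁(x₁)[2F₁(x₁) − 1] dx₁)(∫ x₂ f₂(x₂)[2F₂(x₂) − 1] dx₂) + κ₂ · (∫ x₁ f₁(x₁) F₁(x₁)[3F₁(x₁) − 2] dx₁)(∫ x₂ f₂(x₂) F₂(x₂)[3F₂(x₂) − 2] dx₂). -/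
open MeasureTheory

open Filter Topology in
/-- A primitive on left half-lines satisfies the fundamental theorem of calculus for its powers,
even if the integrand is merely integrable. -/
lemma integral_mul_pow_primitive_Iic {f F : ℝ → ℝ} (hf : Integrable f)
    (hF : ∀ x, F x = ∫ t in Set.Iic x, f t) (n : ℕ)
    (hint : Integrable fun x => f x * F x ^ n) :
    (n + 1) * ∫ x, f x * F x ^ n = (∫ x, f x) ^ (n + 1) := by
  have hsub (a x : ℝ) : F x = F a + ∫ t in a..x, f t := by
    rw [hF, hF, ← intervalIntegral.integral_Iic_sub_Iic hf.integrableOn hf.integrableOn]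
    ring
  have hac (a b : ℝ) (k : ℕ) : AbsolutelyContinuousOnInterval (fun x => F x ^ k) a b := by
    induction k with
    | zero =>
      simpa using (contDiff_const (c := (1 : ℝ))).contDiffOn.absolutelyContinuousOnInterval
    | succ k ih =>
      have hFac : AbsolutelyContinuousOnInterval F a b := by
        have h := (contDiff_const (c := F a)).contDiffOn.absolutelyContinuousOnInterval
          (a := a) (b := b) |>.add
          (hf.intervalIntegrable.absolutelyContinuousOnInterval_intervalIntegral
            (a := a) (b := b) (c := a) (by simp))
        convert! h using 1
        funext x
        simpa using hsub a x
      simpa only [pow_succ] using ih.fun_mul hFac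
  have hderiv : ∀ᵐ x, deriv (fun x => F x ^ (n + 1)) x = (n + 1) * (f x * F x ^ n) := by
    filter_upwards [LocallyIntegrable.ae_hasDerivAt_integral hf.locallyIntegrable] with x hx
    have hFx : HasDerivAt F (f x) x := by
      have h := (hx 0).const_add (F 0)
      rwa [← funext (hsub 0)] at h
    rw [(hFx.fun_pow (n + 1)).deriv]
    push_cast [Nat.add_sub_cancel]
    ring
  have hftc (a b : ℝ) :
      ∫ x in a..b, (n + 1) * (f x * F x ^ n) = F b ^ (n + 1) - F a ^ (n + 1) := by
    rw [← (hac a b (n + 1)).integral_deriv_eq_sub]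
    exact intervalIntegral.integral_congr_ae (by filter_upwards [hderiv] with x hx _ using hx.symm)
  have htop : Tendsto F atTop (𝓝 (∫ x, f x)) := by
    rw [funext hF]
    exact (aecover_Iic tendsto_id).integral_tendsto_of_countably_generated hf
  have hbot : Tendsto F atBot (𝓝 0) := by
    have h : Tendsto (fun a => F 0 - ∫ t in a..0, f t) atBot
        (𝓝 (F 0 - ∫ t in Set.Iic 0, f t)) :=
      (intervalIntegral_tendsto_integral_Iic 0 hf.integrableOn tendsto_id).const_sub _
    rw [← hF, sub_self] at h
    exact h.congr fun a => by rw [hsub a 0]; ring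
  have h₁ := intervalIntegral_tendsto_integral (hint.const_mul ((n : ℝ) + 1))
    tendsto_neg_atTop_atBot tendsto_id
  have h₂ := (htop.pow (n + 1)).sub ((hbot.comp tendsto_neg_atTop_atBot).pow (n + 1))
  rw [← integral_const_mul]
  refine tendsto_nhds_unique h₁ ?_
  simpa [hftc] using h₂

lemma integrable_mul_pow_primitive_Iic {f F φ : ℝ → ℝ} (hf : Integrable f)
    (hF : ∀ x, F x = ∫ t in Set.Iic x, f t) (hφ : Integrable φ) (n : ℕ) :
    Integrable fun x => φ x * F x ^ n := by
  have hcont : Continuous F := by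
    have h : F = fun x => F 0 + ∫ t in (0 : ℝ)..x, f t := by
      funext x
      rw [hF, hF, ← intervalIntegral.integral_Iic_sub_Iic hf.integrableOn hf.integrableOn]
      ring
    rw [h]
    exact continuous_const.add
      (intervalIntegral.continuous_primitive (fun _ _ => hf.intervalIntegrable) 0)
  refine hφ.mul_bdd (c := (∫ x, ‖f x‖) ^ n) (hcont.pow n).aestronglyMeasurable (ae_of_all _ ?_)
  intro x
  rw [norm_pow, hF]
  gcongr
  exact (norm_integral_le_integral_norm _).trans
    (setIntegral_le_integral hf.norm (ae_of_all _ fun _ => norm_nonneg _))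

/-- Centering does not change a first moment whose weight has total mass zero. -/
lemma integral_sub_mul_eq_of_integral_eq_zero {w : ℝ → ℝ} (m : ℝ) (hw : Integrable w)
    (hxw : Integrable fun x => x * w x) (h : ∫ x, w x = 0) :
    Integrable (fun x => (x - m) * w x) ∧ ∫ x, (x - m) * w x = ∫ x, x * w x := by
  simp_rw [sub_mul]
  refine ⟨hxw.sub (hw.const_mul m), ?_⟩
  rw [integral_sub hxw (hw.const_mul m), integral_const_mul, h, mul_zero, sub_zero]

/-- Centered first moments of a density weighted by the two polynomials in its distribution
function that occur in the iterated FGM density. -/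
lemma centered_moments_fgm_weights {f F : ℝ → ℝ} (hf : Integrable f)
    (hnorm : ∫ x, f x = 1) (hxf : Integrable fun x => x * f x)
    (hF : ∀ x, F x = ∫ t in Set.Iic x, f t) {m : ℝ} (hm : m = ∫ x, x * f x) :
    (Integrable (fun x => (x - m) * f x) ∧ ∫ x, (x - m) * f x = 0) ∧
    (Integrable (fun x => (x - m) * (f x * (2 * F x - 1))) ∧
      ∫ x, (x - m) * (f x * (2 * F x - 1)) = ∫ x, x * f x * (2 * F x - 1)) ∧
    (Integrable (fun x => (x - m) * (f x * F x * (3 * F x - 2))) ∧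
      ∫ x, (x - m) * (f x * F x * (3 * F x - 2)) = ∫ x, x * f x * F x * (3 * F x - 2)) := by
  have hi {φ : ℝ → ℝ} (hφ : Integrable φ) (n : ℕ) := integrable_mul_pow_primitive_Iic hf hF hφ n
  have hi₂ {φ : ℝ → ℝ} (hφ : Integrable φ) : Integrable fun x => φ x * (2 * F x - 1) := by
    convert! ((hi hφ 1).const_mul 2).sub hφ using 1
    funext x
    simp only [Pi.sub_apply]
    ring
  have hi₃ {φ : ℝ → ℝ} (hφ : Integrable φ) : Integrable fun x => φ x * F x * (3 * F x - 2) := by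
    convert! ((hi hφ 2).const_mul 3).sub ((hi hφ 1).const_mul 2) using 1
    funext x
    simp only [Pi.sub_apply]
    ring
  have e₁ := integral_mul_pow_primitive_Iic hf hF 1 (hi hf 1)
  have e₂ := integral_mul_pow_primitive_Iic hf hF 2 (hi hf 2)
  rw [hnorm] at e₁ e₂
  norm_num only [Nat.cast_one, Nat.cast_ofNat, one_pow] at e₁ e₂
  have z₂ : ∫ x, f x * (2 * F x - 1) = 0 := by
    have h : (fun x => f x * (2 * F x - 1)) = fun x => 2 * (f x * F x ^ 1) - f x := by
      funext x; ring
    rw [h, integral_sub ((hi hf 1).const_mul 2) hf, integral_const_mul, hnorm]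
    linarith
  have z₃ : ∫ x, f x * F x * (3 * F x - 2) = 0 := by
    have h : (fun x => f x * F x * (3 * F x - 2)) =
        fun x => 3 * (f x * F x ^ 2) - 2 * (f x * F x ^ 1) := by
      funext x; ring
    rw [h, integral_sub ((hi hf 2).const_mul 3) ((hi hf 1).const_mul 2), integral_const_mul,
      integral_const_mul]
    linarith
  refine ⟨⟨?_, ?_⟩, ?_, ?_⟩
  · simp_rw [sub_mul]
    exact hxf.sub (hf.const_mul m)
  · simp_rw [sub_mul]
    rw [integral_sub hxf (hf.const_mul m), integral_const_mul, hnorm, ← hm]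
    ring
  · have h := integral_sub_mul_eq_of_integral_eq_zero m (hi₂ hf)
      (by simpa only [mul_assoc] using hi₂ hxf) z₂
    simpa only [mul_assoc] using h
  · have h := integral_sub_mul_eq_of_integral_eq_zero m (hi₃ hf)
      (by simpa only [mul_assoc] using hi₃ hxf) z₃
    simpa only [mul_assoc] using h

/-- Integral of a linear combination of three integrable functions. -/
lemma integral_linear_combination_three {u v w : ℝ → ℝ} (hu : Integrable u) (hv : Integrable v)
    (hw : Integrable w) (a b c : ℝ) :
    ∫ x, (a * u x + b * v x + c * w x) =
      a * (∫ x, u x) + b * (∫ x, v x) + c * ∫ x, w x := by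
  have huv : Integrable fun x => a * u x + b * v x := (hu.const_mul a).add (hv.const_mul b)
  rw [integral_add huv (hw.const_mul c), integral_add (hu.const_mul a) (hv.const_mul b)]
  simp only [integral_const_mul]

/-- The covariance of the two coordinates under the one-iteration
(Johnson–Kotz) iterated FGM joint density equals
`κ₁ A₁ A₂ + κ₂ B₁ B₂`, where `Aⱼ = ∫ x fⱼ(x)[2Fⱼ(x)-1] dx` and
`Bⱼ = ∫ x fⱼ(x) Fⱼ(x)[3Fⱼ(x)-2] dx`. -/
theorem iterated_fgm_covariance
    (f₁ f₂ : ℝ → ℝ) (κ₁ κ₂ : ℝ)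
    (hf₁pos : ∀ x, 0 ≤ f₁ x) (hf₂pos : ∀ x, 0 ≤ f₂ x)
    (hf₁int : Integrable f₁) (hf₂int : Integrable f₂)
    (hf₁norm : ∫ x, f₁ x = 1) (hf₂norm : ∫ x, f₂ x = 1)
    (hxf₁int : Integrable (fun x => x * f₁ x))
    (hxf₂int : Integrable (fun x => x * f₂ x))
    (hsqf₁int : Integrable (fun x => x ^ 2 * f₁ x))
    (hsqf₂int : Integrable (fun x => x ^ 2 * f₂ x))
    (m₁ m₂ : ℝ) (hm₁ : m₁ = ∫ x, x * f₁ x) (hm₂ : m₂ = ∫ x, x * f₂ x)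
    (F₁ F₂ : ℝ → ℝ)
    (hF₁ : ∀ x, F₁ x = ∫ t in Set.Iic x, f₁ t)
    (hF₂ : ∀ x, F₂ x = ∫ t in Set.Iic x, f₂ t)
    (g : ℝ → ℝ → ℝ)
    (hg : ∀ x₁ x₂, g x₁ x₂ = f₁ x₁ * f₂ x₂ *
      (1 + κ₁ * (2 * F₁ x₁ - 1) * (2 * F₂ x₂ - 1)
         + κ₂ * (F₁ x₁) * (F₂ x₂) * (3 * F₁ x₁ - 2) * (3 * F₂ x₂ - 2))) :
    ∫ x₁, ∫ x₂, (x₁ - m₁) * (x₂ - m₂) * g x₁ x₂ =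
      κ₁ * (∫ x, x * f₁ x * (2 * F₁ x - 1)) * (∫ x, x * f₂ x * (2 * F₂ x - 1))
      + κ₂ * (∫ x, x * f₁ x * F₁ x * (3 * F₁ x - 2)) *
        (∫ x, x * f₂ x * F₂ x * (3 * F₂ x - 2)) := by
  obtain ⟨⟨i₁, e₁⟩, ⟨j₁, e₁'⟩, k₁, e₁''⟩ :=
    centered_moments_fgm_weights hf₁int hf₁norm hxf₁int hF₁ hm₁
  obtain ⟨⟨i₂, e₂⟩, ⟨j₂, e₂'⟩, k₂, e₂''⟩ :=
    centered_moments_fgm_weights hf₂int hf₂norm hxf₂int hF₂ hm₂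
  set A₂ := ∫ x, x * f₂ x * (2 * F₂ x - 1)
  set B₂ := ∫ x, x * f₂ x * F₂ x * (3 * F₂ x - 2)
  have hinner (x₁ : ℝ) : ∫ x₂, (x₁ - m₁) * (x₂ - m₂) * g x₁ x₂ =
      0 * ((x₁ - m₁) * f₁ x₁) + κ₁ * A₂ * ((x₁ - m₁) * (f₁ x₁ * (2 * F₁ x₁ - 1)))
        + κ₂ * B₂ * ((x₁ - m₁) * (f₁ x₁ * F₁ x₁ * (3 * F₁ x₁ - 2))) := by
    have h := integral_linear_combination_three i₂ j₂ k₂ ((x₁ - m₁) * f₁ x₁)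
      (κ₁ * ((x₁ - m₁) * (f₁ x₁ * (2 * F₁ x₁ - 1))))
      (κ₂ * ((x₁ - m₁) * (f₁ x₁ * F₁ x₁ * (3 * F₁ x₁ - 2))))
    rw [e₂, e₂', e₂''] at h
    calc _ = _ := integral_congr_ae (ae_of_all _ fun x₂ => by simp only [hg]; ring)
      _ = _ := h
      _ = _ := by ring
  simp_rw [hinner]
  rw [integral_linear_combination_three i₁ j₁ k₁, e₁, e₁', e₁'']
  ring
end
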